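/- arXiv:1705.09344 — 2 statements merged into one kernel-verified Lean document; each statement's English description precedes it below -/
import Mathlib

section
/- The theta function satisfies the three-term identity: ϑ(α y₁/x) ϑ(h y₂/x) ϑ(h y₁/y₂) ϑ(α) = ϑ(α h y₁/x) ϑ(y₂/x) ϑ(y₁/y₂) ϑ(α/h) + ϑ(h y₁/x) ϑ(α y₂/x) ϑ(h) ϑ(α y₁/y₂), for all nonzero complex x, y₁, y₂, h, α. -/
open Complex

/-- The theta function in additive variables: `θ(u) = ϑ(e^{2πiu})` with
`ϑ(x) = (x^{1/2} − x^{−1/2}) ∏_{s≥0}(1−q^{s+1}x)(1−q^{s+1}/x)`, `q = e^{2πiτ}`,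
`x^{1/2} = e^{πiu}`. -/
noncomputable def ellTheta (τ u : ℂ) : ℂ :=
  (Complex.exp ((Real.pi : ℂ) * Complex.I * u)
      - Complex.exp (-((Real.pi : ℂ) * Complex.I * u))) *
    (∏' s : ℕ, (1 - Complex.exp (2 * (Real.pi : ℂ) * Complex.I * τ) ^ (s + 1) *
        Complex.exp (2 * (Real.pi : ℂ) * Complex.I * u))) *
    (∏' s : ℕ, (1 - Complex.exp (2 * (Real.pi : ℂ) * Complex.I * τ) ^ (s + 1) *
        Complex.exp (-(2 * (Real.pi : ℂ) * Complex.I * u))))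

open Filter Topology

/-- the Gaussian binomial coefficients, by the `q`-Pascal rule -/
noncomputable def qB (q : ℂ) : ℕ → ℕ → ℂ
  | _, 0 => 1
  | 0, _ + 1 => 0
  | N + 1, j + 1 => q ^ (j + 1) * qB q N (j + 1) + qB q N j

/-- the finite product `(1-q)...(1-q^m)` -/
noncomputable def qQ (q : ℂ) (m : ℕ) : ℂ := ∏ i ∈ Finset.range m, (1 - q ^ (i + 1))

lemma qB_zero_right (q : ℂ) (N : ℕ) : qB q N 0 = 1 := by
  cases N <;> simp [qB]

lemma qB_eq_zero (q : ℂ) (N : ℕ) : ∀ j, N < j → qB q N j = 0 := by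
  induction N with
  | zero => intro j hj; obtain ⟨j, rfl⟩ := Nat.exists_eq_succ_of_ne_zero hj.ne'; simp [qB]
  | succ N ih =>
    intro j hj
    obtain ⟨j, rfl⟩ := Nat.exists_eq_succ_of_ne_zero (by omega : j ≠ 0)
    simp [qB, ih j (by omega), ih (j + 1) (by omega)]

lemma qB_mul (q : ℂ) (n : ℕ) : ∀ i j, i + j = n → qB q n j * (qQ q i * qQ q j) = qQ q n := by
  induction n with
  | zero =>
    intro i j h
    obtain ⟨rfl, rfl⟩ : i = 0 ∧ j = 0 := by omega
    simp [qB, qQ]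
  | succ n ih =>
    intro i j h
    rcases j with _ | j
    · obtain rfl : i = n + 1 := by omega
      simp [qB, qQ]
    · rcases i with _ | i
      · obtain rfl : j = n := by omega
        have h1 := ih 0 j (by omega)
        rw [qB, qB_eq_zero q j (j + 1) (by omega)]
        simp only [qQ, Finset.prod_range_succ, Finset.prod_range_zero] at h1 ⊢
        linear_combination (1 - q ^ (j + 1)) * h1
      · have h1 := ih i (j + 1) (by omega)
        have h2 := ih (i + 1) j (by omega)
        obtain rfl : n = i + j + 1 := by omega
        rw [qB]
        simp only [qQ, Finset.prod_range_succ] at h1 h2 ⊢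
        linear_combination (q ^ (j + 1) * (1 - q ^ (i + 1))) * h1 + (1 - q ^ (j + 1)) * h2

lemma q_binomial (q : ℂ) (N : ℕ) : ∀ t : ℂ, ∏ j ∈ Finset.range N, (1 + q ^ j * t) =
    ∑ j ∈ Finset.range (N + 1), q ^ (j.choose 2) * qB q N j * t ^ j := by
  induction N with
  | zero => intro t; simp [qB]
  | succ N ih =>
    intro t
    rw [Finset.prod_range_succ']
    have : ∀ j ∈ Finset.range N, (1 + q ^ (j + 1) * t) = 1 + q ^ j * (q * t) := by
      intro j _; ring
    rw [Finset.prod_congr rfl this, ih (q * t), Finset.sum_range_succ' _ (N + 1)]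
    have h2 : ∀ j ∈ Finset.range (N + 1),
        q ^ ((j + 1).choose 2) * qB q (N + 1) (j + 1) * t ^ (j + 1) =
          q ^ ((j + 1).choose 2) * qB q N (j + 1) * (q * t) ^ (j + 1)
          + t * (q ^ (j.choose 2) * qB q N j * (q * t) ^ j) := by
      intro j _
      have : (j + 1).choose 2 = j.choose 2 + j := by
        rw [Nat.choose_succ_succ' j 1]; simp [add_comm]
      rw [qB, this]; ring
    rw [Finset.sum_congr rfl h2, Finset.sum_add_distrib, ← Finset.mul_sum]
    have h3 := Finset.sum_range_succ' (fun j => q ^ (j.choose 2) * qB q N j * (q * t) ^ j) (N + 1)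
    rw [Finset.sum_range_succ] at h3
    rw [qB_eq_zero q N (N + 1) (by omega)] at h3
    simp only [qB_zero_right] at h3 ⊢
    simp only [Nat.choose_zero_succ, pow_zero, mul_one, mul_zero, zero_mul, add_zero, one_mul] at h3 ⊢
    linear_combination h3

lemma q_summable {q : ℂ} (hq : ‖q‖ < 1) (c : ℂ) : Summable (fun s : ℕ => ‖-(q ^ (s + 1) * c)‖) := by
  simp only [norm_neg, norm_mul, norm_pow]
  exact ((summable_nat_add_iff 1).2 (summable_geometric_of_lt_one (norm_nonneg _) hq)).mul_right _

lemma q_multipliable {q : ℂ} (hq : ‖q‖ < 1) (c : ℂ) :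
    Multipliable (fun s : ℕ => 1 - q ^ (s + 1) * c) := by
  simpa [sub_eq_add_neg] using multipliable_one_add_of_summable (q_summable hq c)

lemma one_sub_pow_ne {q : ℂ} (hq : ‖q‖ < 1) (i : ℕ) : 1 - q ^ (i + 1) ≠ 0 := by
  intro h
  have h1 : ‖q ^ (i + 1)‖ = 1 := by rw [← sub_eq_zero.1 h]; simp
  rw [norm_pow] at h1
  exact absurd h1 (pow_lt_one₀ (norm_nonneg _) hq (by omega)).ne

lemma qQ_ne_zero {q : ℂ} (hq : ‖q‖ < 1) (m : ℕ) : qQ q m ≠ 0 :=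
  Finset.prod_ne_zero_iff.2 fun i _ => one_sub_pow_ne hq i

lemma qQ_tendsto {q : ℂ} (hq : ‖q‖ < 1) : ∃ c : ℂ, c ≠ 0 ∧ Tendsto (qQ q) atTop (𝓝 c) := by
  refine ⟨∏' s : ℕ, (1 - q ^ (s + 1)), ?_, ?_⟩
  · have := tprod_one_add_ne_zero_of_summable (f := fun s : ℕ => -(q ^ (s + 1) * 1))
      (fun i => by simpa [← sub_eq_add_neg] using one_sub_pow_ne hq i) (q_summable hq 1)
    simpa [sub_eq_add_neg] using this
  · have := (q_multipliable hq 1).tendsto_prod_tprod_nat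
    simp only [mul_one] at this
    exact this

lemma qB_bound {q : ℂ} (hq : ‖q‖ < 1) : ∃ M : ℝ, 0 ≤ M ∧ ∀ N j, ‖qB q N j‖ ≤ M := by
  obtain ⟨c, hc, h⟩ := qQ_tendsto hq
  obtain ⟨C, hC⟩ := h.norm.bddAbove_range
  obtain ⟨D, hD⟩ := (h.inv₀ hc).norm.bddAbove_range
  have hC' : ∀ n, ‖qQ q n‖ ≤ C := fun n => hC ⟨n, rfl⟩
  have hD' : ∀ n, ‖(qQ q n)⁻¹‖ ≤ D := fun n => hD ⟨n, rfl⟩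
  have hC0 : 0 ≤ C := (norm_nonneg _).trans (hC' 0)
  have hD0 : 0 ≤ D := (norm_nonneg _).trans (hD' 0)
  refine ⟨C * (D * D), by positivity, fun N j => ?_⟩
  rcases lt_or_ge N j with hj | hj
  · rw [qB_eq_zero q N j hj]; simp; positivity
  · have h1 := qB_mul q N (N - j) j (by omega)
    have h2 : qB q N j = qQ q N * ((qQ q (N - j))⁻¹ * (qQ q j)⁻¹) := by
      have := qQ_ne_zero hq (N - j)
      have := qQ_ne_zero hq j
      field_simp
      linear_combination h1
    rw [h2, norm_mul, norm_mul]
    have := hC' N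
    have := hD' (N - j)
    have := hD' j
    gcongr

lemma qB_tendsto {q : ℂ} (hq : ‖q‖ < 1) : ∃ c : ℂ, ∀ k : ℤ,
    Tendsto (fun n : ℕ => qB q (2 * n) ((n : ℤ) + k).toNat) atTop (𝓝 c) := by
  obtain ⟨c, hc, h⟩ := qQ_tendsto hq
  refine ⟨c * (c⁻¹ * c⁻¹), fun k => ?_⟩
  have t1 : ∀ k : ℤ, Tendsto (fun n : ℕ => ((n : ℤ) + k).toNat) atTop atTop := by
    intro k
    refine tendsto_atTop.2 fun b => ?_
    filter_upwards [eventually_ge_atTop (b + k.natAbs)] with n hn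
    omega
  have t2 : Tendsto (fun n : ℕ => 2 * n) atTop atTop := by
    refine tendsto_atTop.2 fun b => ?_
    filter_upwards [eventually_ge_atTop b] with n hn
    omega
  have h3 := (h.comp t2).mul (((h.comp (t1 (-k))).inv₀ hc).mul ((h.comp (t1 k)).inv₀ hc))
  refine h3.congr' ?_
  filter_upwards [eventually_ge_atTop k.natAbs] with n hn
  have h1 := qB_mul q (2 * n) ((n : ℤ) + -k).toNat ((n : ℤ) + k).toNat (by omega)
  have := qQ_ne_zero hq ((n : ℤ) + -k).toNat
  have := qQ_ne_zero hq ((n : ℤ) + k).toNat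
  simp only [Function.comp]
  field_simp
  linear_combination -h1

/-- general term of the theta series -/
noncomputable def tTerm (τ u : ℂ) (k : ℤ) : ℂ :=
  Complex.exp (Real.pi * I * k + Real.pi * I * τ * (k + 1 / 2) ^ 2 + 2 * Real.pi * I * (k + 1 / 2) * u)

noncomputable def eTerm (τ u : ℂ) (n : ℤ) : ℂ :=
  Complex.exp (Real.pi * I * τ * (2 * n) ^ 2 / 2 + 2 * Real.pi * I * (2 * n) * u)

noncomputable def oTerm (τ u : ℂ) (n : ℤ) : ℂ :=
  Complex.exp (Real.pi * I * τ * (2 * n + 1) ^ 2 / 2 + 2 * Real.pi * I * (2 * n + 1) * u)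

lemma summable_jt {τ : ℂ} (hτ : 0 < τ.im) (z c : ℂ) :
    Summable (fun k : ℤ => c * jacobiTheta₂_term k z τ) :=
  ((summable_jacobiTheta₂_term_iff z τ).2 hτ).mul_left c

lemma tTerm_summable {τ : ℂ} (hτ : 0 < τ.im) (u : ℂ) : Summable (tTerm τ u) := by
  convert summable_jt hτ (u + τ / 2 + 1 / 2) (Complex.exp (Real.pi * I * τ / 4 + Real.pi * I * u)) using 2 with k
  rw [tTerm, jacobiTheta₂_term, ← Complex.exp_add]
  congr 1; ring

lemma two_im {τ : ℂ} (hτ : 0 < τ.im) : 0 < (2 * τ).im := by simpa using hτ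

lemma eTerm_summable {τ : ℂ} (hτ : 0 < τ.im) (u : ℂ) : Summable (eTerm τ u) := by
  convert summable_jt (two_im hτ) (2 * u) 1 using 2 with k
  rw [eTerm, jacobiTheta₂_term, one_mul]
  congr 1; ring

lemma oTerm_summable {τ : ℂ} (hτ : 0 < τ.im) (u : ℂ) : Summable (oTerm τ u) := by
  convert summable_jt (two_im hτ) (2 * u + τ) (Complex.exp (Real.pi * I * τ / 2 + 2 * Real.pi * I * u)) using 2 with k
  rw [oTerm, jacobiTheta₂_term, ← Complex.exp_add]
  congr 1; ring

lemma parity_bij : Function.Bijective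
    (Sum.elim (fun p : ℤ × ℤ => (p.1 + p.2, p.1 - p.2)) (fun p : ℤ × ℤ => (p.1 + p.2, p.1 - p.2 - 1))) := by
  constructor
  · rintro (⟨a, b⟩ | ⟨a, b⟩) (⟨c, d⟩ | ⟨c, d⟩) h <;> simp at h ⊢ <;> omega
  · rintro ⟨k, l⟩
    rcases Int.even_or_odd' (k + l) with ⟨m, hm | hm⟩
    · exact ⟨Sum.inl (m, k - m), by simp; omega⟩
    · exact ⟨Sum.inr (m + 1, k - m - 1), by simp; omega⟩

lemma exp_int_even (n : ℤ) (z : ℂ) : Complex.exp (2 * Real.pi * I * n + z) = Complex.exp z := by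
  rw [Complex.exp_add, show (2 * Real.pi * I * n : ℂ) = n * (2 * Real.pi * I) by ring,
    Complex.exp_int_mul_two_pi_mul_I, one_mul]

lemma exp_int_odd (n : ℤ) (z : ℂ) :
    Complex.exp (2 * Real.pi * I * n - Real.pi * I + z) = - Complex.exp z := by
  rw [show (2 * Real.pi * I * n - Real.pi * I + z : ℂ) = 2 * Real.pi * I * n + (z - Real.pi * I) by ring,
    exp_int_even, Complex.exp_sub, Complex.exp_pi_mul_I, div_neg, div_one]

lemma t_add {τ : ℂ} (hτ : 0 < τ.im) (x y : ℂ) :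
    (∑' k, tTerm τ (x + y) k) * (∑' k, tTerm τ (x - y) k) =
      (∑' k, oTerm τ x k) * (∑' k, eTerm τ y k) - (∑' k, eTerm τ x k) * (∑' k, oTerm τ y k) := by
  have ht := (tTerm_summable hτ (x + y)).norm
  have ht' := (tTerm_summable hτ (x - y)).norm
  have s1 := summable_mul_of_summable_norm ht ht'
  rw [tsum_mul_tsum_of_summable_norm ht ht',
    tsum_mul_tsum_of_summable_norm (oTerm_summable hτ x).norm (eTerm_summable hτ y).norm,
    tsum_mul_tsum_of_summable_norm (eTerm_summable hτ x).norm (oTerm_summable hτ y).norm]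
  have so := summable_mul_of_summable_norm (oTerm_summable hτ x).norm (eTerm_summable hτ y).norm
  have se := summable_mul_of_summable_norm (eTerm_summable hτ x).norm (oTerm_summable hτ y).norm
  rw [← (Equiv.ofBijective _ parity_bij).tsum_eq]
  have e1 : ∀ p : ℤ × ℤ, tTerm τ (x + y) (p.1 + p.2) * tTerm τ (x - y) (p.1 - p.2) =
      oTerm τ x p.1 * eTerm τ y p.2 := by
    rintro ⟨a, b⟩
    simp only [tTerm, oTerm, eTerm, ← Complex.exp_add]
    conv_rhs => rw [← exp_int_even a]
    congr 1; push_cast; ring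
  have e2 : ∀ p : ℤ × ℤ, tTerm τ (x + y) (p.1 + p.2) * tTerm τ (x - y) (p.1 - p.2 - 1) =
      -(eTerm τ x p.1 * oTerm τ y p.2) := by
    rintro ⟨a, b⟩
    simp only [tTerm, oTerm, eTerm, ← Complex.exp_add]
    rw [← exp_int_odd a]
    congr 1; push_cast; ring
  have hs : HasSum (fun c : (ℤ × ℤ) ⊕ (ℤ × ℤ) =>
      tTerm τ (x + y) ((Equiv.ofBijective _ parity_bij) c).1 *
        tTerm τ (x - y) ((Equiv.ofBijective _ parity_bij) c).2)
      ((∑' p : ℤ × ℤ, oTerm τ x p.1 * eTerm τ y p.2) + -(∑' p : ℤ × ℤ, eTerm τ x p.1 * oTerm τ y p.2)) := by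
    refine HasSum.sum ?_ ?_
    · exact (funext e1 : (fun p : ℤ × ℤ => _) = _) ▸ so.hasSum
    · have h2 := se.hasSum.neg
      simp only [← e2] at h2
      exact h2
  rw [hs.tsum_eq]; ring

lemma prod_exp_lin (a b : ℂ) (n : ℕ) : ∏ s ∈ Finset.range n, -Complex.exp (a * s + b) =
    Complex.exp (Real.pi * I * n + a * (n * (n - 1) / 2) + b * n) := by
  induction n with
  | zero => simp
  | succ n ih =>
    rw [Finset.prod_range_succ, ih, ← Complex.exp_sub_pi_mul_I, ← Complex.exp_add,
      ← exp_int_even 1 (Real.pi * I * n + _ + _ + _)]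
    congr 1; push_cast; ring

lemma choose_two_cast (j : ℕ) : ((j.choose 2 : ℕ) : ℂ) = j * (j - 1) / 2 := by
  exact Nat.cast_choose_two ℂ j

lemma finite_triple (τ u : ℂ) (n : ℕ) :
    (∏ s ∈ Finset.range n, (1 - Complex.exp (2 * Real.pi * I * τ) ^ (s + 1) *
        Complex.exp (2 * Real.pi * I * u))) *
    (∏ s ∈ Finset.range n, (1 - Complex.exp (2 * Real.pi * I * τ) ^ s *
        Complex.exp (-(2 * Real.pi * I * u)))) =
    Complex.exp (-(Real.pi * I * τ / 4) - Real.pi * I * u) *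
    ∑ j ∈ Finset.range (2 * n + 1), qB (Complex.exp (2 * Real.pi * I * τ)) (2 * n) j *
      tTerm τ u ((j : ℤ) - n) := by
  set q := Complex.exp (2 * Real.pi * I * τ) with hq
  have hqp : ∀ m : ℕ, q ^ m = Complex.exp (2 * Real.pi * I * τ * m) := by
    intro m; rw [hq, ← Complex.exp_nat_mul]; congr 1; ring
  -- the base point of the `q`-binomial theorem
  set t := -Complex.exp (2 * Real.pi * I * u + 2 * Real.pi * I * τ * (1 - n)) with ht
  have h2 : ∀ s ∈ Finset.range n, (1 - q ^ s * Complex.exp (-(2 * Real.pi * I * u))) =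
      -Complex.exp (2 * Real.pi * I * τ * s + -(2 * Real.pi * I * u)) *
        (1 + q ^ (n - 1 - s) * t) := by
    intro s hs
    have hs' := Finset.mem_range.1 hs
    have hc : ((n - 1 - s : ℕ) : ℂ) = n - 1 - s := by
      rw [Nat.sub_sub, Nat.cast_sub (by omega)]; push_cast; ring
    rw [hqp, hqp, ht, hc, mul_add, mul_neg, neg_mul_neg, ← Complex.exp_add, ← Complex.exp_add,
      ← Complex.exp_add, mul_one]
    have h0 : Complex.exp (2 * Real.pi * I * τ * s + -(2 * Real.pi * I * u) +
        (2 * Real.pi * I * τ * (n - 1 - s) + (2 * Real.pi * I * u + 2 * Real.pi * I * τ * (1 - n)))) = 1 := by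
      rw [← Complex.exp_zero]; congr 1; ring
    rw [h0]; ring
  have h1 : ∀ s ∈ Finset.range n, (1 - q ^ (s + 1) * Complex.exp (2 * Real.pi * I * u)) =
      1 + q ^ (n + s) * t := by
    intro s _
    rw [hqp, hqp, ht, mul_neg, ← sub_eq_add_neg, ← Complex.exp_add, ← Complex.exp_add]
    congr 2; push_cast; ring
  rw [Finset.prod_congr rfl h1, Finset.prod_congr rfl h2, Finset.prod_mul_distrib,
    Finset.prod_range_reflect (fun s => 1 + q ^ s * t) n, prod_exp_lin]
  have h3 : (∏ s ∈ Finset.range n, (1 + q ^ (n + s) * t)) *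
      (∏ s ∈ Finset.range n, (1 + q ^ s * t)) = ∏ s ∈ Finset.range (2 * n), (1 + q ^ s * t) := by
    rw [two_mul, Finset.prod_range_add, mul_comm]
  rw [mul_left_comm, h3, q_binomial, Finset.mul_sum, Finset.mul_sum]
  refine Finset.sum_congr rfl fun j _ => ?_
  have ht' : t ^ j = Complex.exp (j * (2 * Real.pi * I * u + 2 * Real.pi * I * τ * (1 - n) + Real.pi * I)) := by
    rw [ht, Complex.exp_nat_mul, Complex.exp_add_pi_mul_I]
  rw [ht', hqp, choose_two_cast, tTerm]
  have h5 : ∀ a b d e f B : ℂ, a * b * d = e * f → a * (b * B * d) = e * (B * f) := by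
    intro a b d e f B h
    linear_combination B * h
  apply h5
  rw [← Complex.exp_add, ← Complex.exp_add, ← Complex.exp_add]
  conv_rhs => rw [← exp_int_even n]
  congr 1; push_cast; ring

lemma theta_eq {τ : ℂ} (hτ : 0 < τ.im) : ∃ c : ℂ, ∀ u, ellTheta τ u = c * ∑' k, tTerm τ u k := by
  set q := Complex.exp (2 * Real.pi * I * τ) with hqd
  have hq : ‖q‖ < 1 := by
    rw [hqd, Complex.norm_exp]
    simp
    positivity
  obtain ⟨c, hc⟩ := qB_tendsto hq
  obtain ⟨M, hM0, hM⟩ := qB_bound hq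
  refine ⟨Complex.exp (-(Real.pi * I * τ / 4)) * c, fun u => ?_⟩
  let f : ℕ → ℤ → ℂ := fun n k =>
    if 0 ≤ (n : ℤ) + k then qB q (2 * n) ((n : ℤ) + k).toNat * tTerm τ u k else 0
  have hlim : Tendsto (fun n => ∑' k, f n k) atTop (𝓝 (∑' k, c * tTerm τ u k)) := by
    refine tendsto_tsum_of_dominated_convergence
      (bound := fun k => M * ‖tTerm τ u k‖) ((tTerm_summable hτ u).norm.mul_left M) ?_ ?_
    · intro k
      refine ((hc k).mul_const _).congr' ?_
      filter_upwards [eventually_ge_atTop k.natAbs] with n hn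
      simp only [f]
      rw [if_pos (by omega)]
    · refine Eventually.of_forall fun n k => ?_
      simp only [f]
      split_ifs
      · rw [norm_mul]; gcongr; exact hM _ _
      · simp; positivity
  have hf : ∀ n, ∑' k, f n k = ∑ j ∈ Finset.range (2 * n + 1), qB q (2 * n) j *
      tTerm τ u ((j : ℤ) - n) := by
    intro n
    have hi : Function.Injective (fun j : ℕ => (j : ℤ) - n) := by
      intro a b h; simp at h; exact h
    rw [← hi.tsum_eq (f := f n)]
    · rw [tsum_eq_sum (s := Finset.range (2 * n + 1))]
      · refine Finset.sum_congr rfl fun j _ => ?_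
        simp [f]
      · intro j hj
        simp at hj
        simp [f, qB_eq_zero q (2 * n) j (by omega)]
    · intro k hk
      have : 0 ≤ (n : ℤ) + k := by
        by_contra h
        simp [f, h] at hk
      exact ⟨((n : ℤ) + k).toNat, by simp; omega⟩
  simp_rw [hf] at hlim
  have hm1 := (q_multipliable hq (Complex.exp (2 * Real.pi * I * u))).tendsto_prod_tprod_nat
  have hm2 := (q_multipliable hq (Complex.exp (-(2 * Real.pi * I * u)))).tendsto_prod_tprod_nat
  have hm3 : Tendsto (fun n : ℕ => ∏ s ∈ Finset.range n, (1 - q ^ s *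
      Complex.exp (-(2 * Real.pi * I * u)))) atTop (𝓝 ((∏' s : ℕ, (1 - q ^ (s + 1) *
        Complex.exp (-(2 * Real.pi * I * u)))) * (1 - Complex.exp (-(2 * Real.pi * I * u))))) := by
    rw [← tendsto_add_atTop_iff_nat 1]
    simp_rw [Finset.prod_range_succ', pow_zero, one_mul]
    exact hm2.mul_const _
  have h1 := hm1.mul hm3
  have h2 := hlim.const_mul (Complex.exp (-(Real.pi * I * τ / 4) - Real.pi * I * u))
  have h3 := tendsto_nhds_unique (h1.congr fun n => finite_triple τ u n) h2
  rw [tsum_mul_left, sub_eq_add_neg (-(Real.pi * I * τ / 4)), Complex.exp_add] at h3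
  have h4 : Complex.exp (Real.pi * I * u) * Complex.exp (-(Real.pi * I * u)) = 1 := by
    rw [← Complex.exp_add]; simp
  have h5 : Complex.exp (-(2 * Real.pi * I * u)) =
      Complex.exp (-(Real.pi * I * u)) * Complex.exp (-(Real.pi * I * u)) := by
    rw [← Complex.exp_add]; congr 1; ring
  rw [ellTheta, ← hqd]
  generalize (∏' s : ℕ, (1 - q ^ (s + 1) * Complex.exp (2 * Real.pi * I * u))) = P1 at *
  generalize (∏' s : ℕ, (1 - q ^ (s + 1) * Complex.exp (-(2 * Real.pi * I * u)))) = P2 at *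
  generalize (∑' k, tTerm τ u k) = S at *
  rw [h5] at h3
  linear_combination Complex.exp (Real.pi * I * u) * h3 +
    (P1 * P2 * Complex.exp (-(Real.pi * I * u)) + Complex.exp (-(Real.pi * I * τ / 4)) * c * S) * h4

/-- the three-term theta identity
ϑ(α y₁/x) ϑ(h y₂/x) ϑ(h y₁/y₂) ϑ(α)
  = ϑ(α h y₁/x) ϑ(y₂/x) ϑ(y₁/y₂) ϑ(α/h) + ϑ(h y₁/x) ϑ(α y₂/x) ϑ(h) ϑ(α y₁/y₂),
stated in additive variables `x = e^{2πiX}`, `y_i = e^{2πiY_i}`, `h = e^{2πiH}`,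
`α = e^{2πiA}`. -/
theorem theta_three_term_identity (τ : ℂ) (hτ : 0 < τ.im) (X Y₁ Y₂ H A : ℂ) :
    ellTheta τ (A + Y₁ - X) * ellTheta τ (H + Y₂ - X) * ellTheta τ (H + Y₁ - Y₂) *
        ellTheta τ A
      = ellTheta τ (A + H + Y₁ - X) * ellTheta τ (Y₂ - X) * ellTheta τ (Y₁ - Y₂) *
          ellTheta τ (A - H)
        + ellTheta τ (H + Y₁ - X) * ellTheta τ (A + Y₂ - X) * ellTheta τ H *
          ellTheta τ (A + Y₁ - Y₂) := by
  obtain ⟨c, hc⟩ := theta_eq hτ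
  have key : ∀ a b x y : ℂ, a = x + y → b = x - y → ellTheta τ a * ellTheta τ b = c ^ 2 *
      ((∑' k, oTerm τ x k) * (∑' k, eTerm τ y k) - (∑' k, eTerm τ x k) * (∑' k, oTerm τ y k)) := by
    rintro a b x y rfl rfl
    rw [hc, hc, ← t_add hτ]; ring
  have k1 := key (A + Y₁ - X) A (A + (Y₁ - X) / 2) ((Y₁ - X) / 2) (by ring) (by ring)
  have k2 := key (H + Y₂ - X) (H + Y₁ - Y₂) (H + (Y₁ - X) / 2) (Y₂ - X - (Y₁ - X) / 2)
    (by ring) (by ring)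
  have k3 := key (A + H + Y₁ - X) (A - H) (A + (Y₁ - X) / 2) (H + (Y₁ - X) / 2)
    (by ring) (by ring)
  have k4 := key (Y₂ - X) (Y₁ - Y₂) ((Y₁ - X) / 2) (Y₂ - X - (Y₁ - X) / 2)
    (by ring) (by ring)
  have k5 := key (H + Y₁ - X) H (H + (Y₁ - X) / 2) ((Y₁ - X) / 2) (by ring) (by ring)
  have k6 := key (A + Y₂ - X) (A + Y₁ - Y₂) (A + (Y₁ - X) / 2) (Y₂ - X - (Y₁ - X) / 2)
    (by ring) (by ring)
  rw [show ∀ a b c d : ℂ, a * b * c * d = (a * d) * (b * c) by intros; ring, k1, k2,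
    show ∀ a b c d : ℂ, a * b * c * d = (a * d) * (b * c) by intros; ring, k3, k4,
    show ∀ a b c d : ℂ, a * b * c * d = (a * c) * (b * d) by intros; ring, k5, k6]
  ring
end

section
/- The q → 0 limit of the N = 2, n = 2, λ = (1,1) elliptic weight function recovers the trigonometric one: with μⱼ = e^{2πiτνⱼ} (j = 1,2), ν in the alcove with integer characteristic m_{1,2} and fixed t, z₁, z₂, h, as q = e^{2πiτ} → 0 one has W^{ell}_{id,({1},{2})}(t, z₁, z₂, h, μ) → c(h) h^{−ℓ_I/2} X(t)^{−1/2} W^Δ_{id,({1},{2})}(t, z₁, z₂, h), where ℓ_I = 0, c(h) = (−1)² h^{−1/2} = h^{−1/2}, X(t) = z₁ z₂ / t², and W^Δ_{id,({1},{2})} = (1−h)(t/z₁)^{m_{1,2}}(1 − z₂/t). -/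
open Filter

/-- The product part of the theta function: `φ(qy)φ(q/y) = ∏_{s≥0}(1−q^{s+1}y)(1−q^{s+1}/y)`. -/
noncomputable def thetaProd (q : ℝ) (y : ℂ) : ℂ :=
  (∏' s : ℕ, (1 - (q : ℂ) ^ (s + 1) * y)) * (∏' s : ℕ, (1 - (q : ℂ) ^ (s + 1) / y))

open Topology

noncomputable def qPoch (q : ℝ) (x : ℂ) : ℂ := ∏' s : ℕ, (1 - (q : ℂ) ^ s * x)

noncomputable def thF (q : ℝ) (x : ℂ) : ℂ := qPoch q x * qPoch q ((q : ℂ) / x)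

lemma qPoch_summable {q : ℝ} (h0 : 0 < q) (h1 : q < 1) (x : ℂ) :
    Summable (fun s : ℕ => ‖-((q : ℂ) ^ s * x)‖) := by
  have : (fun s : ℕ => ‖-((q : ℂ) ^ s * x)‖) = fun s : ℕ => q ^ s * ‖x‖ := by
    funext s
    rw [norm_neg, norm_mul, norm_pow, Complex.norm_real, Real.norm_of_nonneg h0.le]
  rw [this]
  exact (summable_geometric_of_lt_one h0.le h1).mul_right _

lemma qPoch_multipliable {q : ℝ} (h0 : 0 < q) (h1 : q < 1) (x : ℂ) :
    Multipliable (fun s : ℕ => (1 - (q : ℂ) ^ s * x)) := by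
  have := multipliable_one_add_of_summable (qPoch_summable h0 h1 x)
  simpa [sub_eq_add_neg] using this

lemma qPoch_shift {q : ℝ} (h0 : 0 < q) (h1 : q < 1) (x : ℂ) :
    qPoch q x = (1 - x) * qPoch q (q * x) := by
  have e : ∀ s : ℕ, (1 - (q : ℂ) ^ (s + 1) * x) = 1 - (q : ℂ) ^ s * (q * x) := by
    intro s; ring
  unfold qPoch
  rw [tprod_eq_zero_mul' (f := fun s : ℕ => (1 - (q : ℂ) ^ s * x))]
  · simp only [e]; simp
  · simp only [e]; exact qPoch_multipliable h0 h1 _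

lemma thetaProd_eq (q : ℝ) (x : ℂ) :
    thetaProd q x = qPoch q (q * x) * qPoch q (q / x) := by
  unfold thetaProd qPoch
  congr 1 <;> (apply tprod_congr; intro s; ring)

lemma thF_eq {q : ℝ} (h0 : 0 < q) (h1 : q < 1) (x : ℂ) :
    (1 - x) * thetaProd q x = thF q x := by
  rw [thetaProd_eq, thF, qPoch_shift h0 h1 x]; ring

lemma thF_step {q : ℝ} (h0 : 0 < q) (h1 : q < 1) (x : ℂ) (hx : x ≠ 0) :
    thF q (q * x) = -x⁻¹ * thF q x := by
  have hq : (q : ℂ) ≠ 0 := by exact_mod_cast h0.ne'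
  have e : (q : ℂ) / (q * x) = x⁻¹ := by field_simp
  have e2 : (q : ℂ) * x⁻¹ = q / x := rfl
  unfold thF
  rw [e, qPoch_shift h0 h1 x⁻¹, qPoch_shift h0 h1 x, e2]
  field_simp
  ring

lemma thF_zstep {q : ℝ} (h0 : 0 < q) (h1 : q < 1) (m : ℤ) :
    ∃ c : ℂ, c ≠ 0 ∧ ∀ x : ℂ, x ≠ 0 → thF q ((q : ℂ) ^ m * x) = c * x ^ (-m) * thF q x := by
  have hq : (q : ℂ) ≠ 0 := by exact_mod_cast h0.ne'
  induction m using Int.induction_on with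
  | zero => exact ⟨1, one_ne_zero, fun x hx => by simp⟩
  | succ k ih =>
    obtain ⟨c, hc, ih⟩ := ih
    have hk : (q : ℂ) ^ (k : ℤ) ≠ 0 := zpow_ne_zero _ hq
    refine ⟨-c * ((q : ℂ) ^ (k : ℤ))⁻¹, by simp [hc, hq], fun x hx => ?_⟩
    rw [zpow_add_one₀ hq, show (q : ℂ) ^ (k : ℤ) * q * x = q * ((q : ℂ) ^ (k : ℤ) * x) by ring,
      thF_step h0 h1 _ (mul_ne_zero hk hx), ih x hx,
      show (-((k : ℤ) + 1)) = -(k : ℤ) - 1 by ring, zpow_sub_one₀ hx, mul_inv]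
    ring
  | pred k ih =>
    obtain ⟨c, hc, ih⟩ := ih
    have hk : (q : ℂ) ^ (-(k : ℤ) - 1) ≠ 0 := zpow_ne_zero _ hq
    refine ⟨-c * (q : ℂ) ^ (-(k : ℤ) - 1), by
      exact mul_ne_zero (neg_ne_zero.mpr hc) hk, fun x hx => ?_⟩
    have h2 := thF_step h0 h1 _ (mul_ne_zero hk hx)
    have e : (q : ℂ) * ((q : ℂ) ^ (-(k : ℤ) - 1) * x) = (q : ℂ) ^ (-(k : ℤ)) * x := by
      rw [zpow_sub_one₀ hq]; field_simp
    rw [e, ih x hx] at h2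
    rw [show (-(-(k : ℤ) - 1)) = -(-(k : ℤ)) + 1 by ring, zpow_add_one₀ hx]
    generalize (q : ℂ) ^ (-(k : ℤ) - 1) = A at *
    generalize x ^ (-(-(k : ℤ))) = B at *
    have h3 : thF q (A * x) = -(A * x) * (-(A * x)⁻¹ * thF q (A * x)) := by
      field_simp
    rw [h3, ← h2]; ring

lemma qPoch_bound {q : ℝ} (h0 : 0 < q) (h1 : q < 1 / 2) (x : ℂ) :
    ‖qPoch q x - 1‖ ≤ Real.exp (2 * ‖x‖) - 1 := by
  have hm := (qPoch_multipliable h0 (by linarith) x).hasProd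
  have ht : Tendsto (fun s : Finset ℕ => ‖∏ i ∈ s, (1 - (q : ℂ) ^ i * x) - 1‖) atTop
      (𝓝 ‖qPoch q x - 1‖) := (Tendsto.sub_const (by simpa [HasProd, qPoch] using hm) 1).norm
  refine le_of_tendsto ht (Eventually.of_forall fun s => ?_)
  have := s.norm_prod_one_add_sub_one_le (fun i => -((q : ℂ) ^ i * x))
  simp only [← sub_eq_add_neg] at this
  refine this.trans ?_
  have hs : ∑ i ∈ s, ‖-((q : ℂ) ^ i * x)‖ ≤ 2 * ‖x‖ := by
    refine ((qPoch_summable h0 (by linarith) x).sum_le_tsum s (fun _ _ => norm_nonneg _)).trans ?_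
    have : (fun s : ℕ => ‖-((q : ℂ) ^ s * x)‖) = fun s : ℕ => q ^ s * ‖x‖ := by
      funext s
      rw [norm_neg, norm_mul, norm_pow, Complex.norm_real, Real.norm_of_nonneg h0.le]
    rw [this, tsum_mul_right, tsum_geometric_of_lt_one h0.le (by linarith)]
    gcongr
    rw [inv_le_comm₀ (by linarith) (by norm_num)]
    linarith
  have := Real.exp_le_exp.mpr hs
  linarith

lemma ev_small : ∀ᶠ q : ℝ in 𝓝[>] 0, 0 < q ∧ q < 1 / 2 :=
  Ioo_mem_nhdsGT (by norm_num)

lemma qPoch_tendsto {f : ℝ → ℂ} (hf : Tendsto f (𝓝[>] 0) (𝓝 0)) :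
    Tendsto (fun q => qPoch q (f q)) (𝓝[>] 0) (𝓝 1) := by
  rw [tendsto_iff_norm_sub_tendsto_zero]
  have hb : Tendsto (fun q => Real.exp (2 * ‖f q‖) - 1) (𝓝[>] (0 : ℝ)) (𝓝 0) := by
    have h1 := ((Real.continuous_exp.tendsto _).comp (hf.norm.const_mul 2)).sub_const 1
    simpa using h1
  refine squeeze_zero' (Eventually.of_forall fun _ => norm_nonneg _) ?_ hb
  filter_upwards [ev_small] with q hq using qPoch_bound hq.1 hq.2 _

lemma ofReal_tendsto : Tendsto (fun q : ℝ => (q : ℂ)) (𝓝[>] 0) (𝓝 0) :=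
  (Complex.continuous_ofReal.tendsto' 0 0 (by simp)).mono_left nhdsWithin_le_nhds

lemma rpow_tendsto {e : ℝ} (he : 0 < e) :
    Tendsto (fun q : ℝ => ((q ^ e : ℝ) : ℂ)) (𝓝[>] 0) (𝓝 0) := by
  have h1 : Tendsto (fun q : ℝ => q ^ e) (𝓝 0) (𝓝 0) := by
    have := (Real.continuousAt_rpow_const 0 e (Or.inr he.le)).tendsto
    rwa [Real.zero_rpow he.ne'] at this
  exact (Complex.continuous_ofReal.tendsto' 0 0 (by simp)).comp (h1.mono_left nhdsWithin_le_nhds)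

lemma thetaProd_tendsto (x : ℂ) :
    Tendsto (fun q => thetaProd q x) (𝓝[>] 0) (𝓝 1) := by
  simp only [thetaProd_eq]
  have h1 := qPoch_tendsto (f := fun q => (q : ℂ) * x) (by simpa using ofReal_tendsto.mul_const x)
  have h2 := qPoch_tendsto (f := fun q => (q : ℂ) / x) (by simpa using ofReal_tendsto.div_const x)
  simpa using h1.mul h2

lemma thF_tendsto (a : ℂ) {ε : ℝ} (h0 : 0 < ε) (h1 : ε < 1) :
    Tendsto (fun q : ℝ => thF q (a * ((q ^ ε : ℝ) : ℂ))) (𝓝[>] 0) (𝓝 1) := by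
  unfold thF
  have t1 := qPoch_tendsto (f := fun q => a * ((q ^ ε : ℝ) : ℂ))
    (by simpa using (rpow_tendsto h0).const_mul a)
  have t2 := qPoch_tendsto (f := fun q => (q : ℂ) / (a * ((q ^ ε : ℝ) : ℂ))) (by
    have h := (rpow_tendsto (e := 1 - ε) (by linarith)).const_mul a⁻¹
    rw [mul_zero] at h
    refine h.congr' ?_
    filter_upwards [ev_small] with q hq
    rw [Real.rpow_sub hq.1, Real.rpow_one]
    push_cast
    rw [div_mul_eq_div_div_swap, div_eq_mul_inv _ a]
    ring)
  simpa using t1.mul t2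

/-- One theta factor rewritten. -/
lemma theta_factor {q : ℝ} (h0 : 0 < q) (h1 : q < 1) (s Q a x : ℂ) (hs : s ≠ 0) (hQ0 : Q ≠ 0)
    (hx : (s * Q) ^ 2 = a * x) :
    (s * Q - (s * Q)⁻¹) * thetaProd q (a * x) = -(s * Q)⁻¹ * thF q (a * x) := by
  rw [← thF_eq h0 h1, ← hx]
  field_simp
  ring

/-- the q → 0 limit of the N = 2, n = 2, λ = (1,1) elliptic weight
function `W^{ell}_{id,({1},{2})} = ϑ(h) ϑ(z₂/t) ϑ(h(z₁/t)q^{m+ε}) / ϑ(h q^{m+ε})`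
(with `μ₂/μ₁ = q^{m+ε}`, `m = m_{1,2}`, `ε ∈ (0,1)`) recovers the trigonometric
one: the limit is `c(h) h^{−ℓ_I/2} X(t)^{−1/2} W^Δ` with `ℓ_I = 0`,
`c(h) = h^{−1/2}`, `X(t) = z₁z₂/t²` and `W^Δ = (1−h)(t/z₁)^{m_{1,2}} (1−z₂/t)`.
Here `sq` is a compatible branch of the square root, `Q q = q^{(m+ε)/2}`,
`Qe q = q^{m+ε}`, and `q → 0` along positive real `q`. -/
theorem elliptic_to_trig_limit_n2
    (t z₁ z₂ h : ℂ) (ht : t ≠ 0) (hz₁ : z₁ ≠ 0) (hz₂ : z₂ ≠ 0) (hh : h ≠ 0)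
    (m : ℤ) (ε : ℝ) (hε0 : 0 < ε) (hε1 : ε < 1)
    (sq : ℂ → ℂ) (hsq : ∀ y : ℂ, (sq y) ^ 2 = y)
    (hsq₁ : sq (h * (z₁ / t)) = sq h * sq (z₁ / t))
    (hsq₂ : sq (z₁ * z₂ / t ^ 2) = sq (z₁ / t) * sq (z₂ / t))
    (Q Qe : ℝ → ℂ)
    (hQ : ∀ q : ℝ, Q q = (Real.rpow q (((m : ℝ) + ε) / 2) : ℂ))
    (hQe : ∀ q : ℝ, Qe q = (Real.rpow q ((m : ℝ) + ε) : ℂ)) :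
    Tendsto
      (fun q : ℝ =>
        (sq h - (sq h)⁻¹) * thetaProd q h *
        ((sq (z₂ / t) - (sq (z₂ / t))⁻¹) * thetaProd q (z₂ / t)) *
        ((sq (h * (z₁ / t)) * Q q - (sq (h * (z₁ / t)) * Q q)⁻¹) *
            thetaProd q (h * (z₁ / t) * Qe q)) /
        ((sq h * Q q - (sq h * Q q)⁻¹) * thetaProd q (h * Qe q)))
      (nhdsWithin 0 (Set.Ioi 0))
      (nhds ((sq h)⁻¹ * (sq (z₁ * z₂ / t ^ 2))⁻¹ *
        ((1 - h) * (t / z₁) ^ m * (1 - z₂ / t)))) := by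
  have hzt : z₁ / t ≠ 0 := div_ne_zero hz₁ ht
  have hw : z₂ / t ≠ 0 := div_ne_zero hz₂ ht
  have sne : ∀ y : ℂ, y ≠ 0 → sq y ≠ 0 := by
    intro y hy h0
    have := hsq y
    rw [h0] at this
    exact hy (by simpa using this.symm)
  have lim : Tendsto (fun q : ℝ =>
      (sq h - (sq h)⁻¹) * thetaProd q h *
        ((sq (z₂ / t) - (sq (z₂ / t))⁻¹) * thetaProd q (z₂ / t)) *
        (((sq (z₁ / t))⁻¹ * (t / z₁) ^ m) *
          (thF q (h * (z₁ / t) * ((q ^ ε : ℝ) : ℂ)) / thF q (h * ((q ^ ε : ℝ) : ℂ)))))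
      (𝓝[>] 0) (𝓝 ((sq h - (sq h)⁻¹) * 1 * ((sq (z₂ / t) - (sq (z₂ / t))⁻¹) * 1) *
        (((sq (z₁ / t))⁻¹ * (t / z₁) ^ m) * (1 / 1)))) :=
    (((thetaProd_tendsto h).const_mul _).mul ((thetaProd_tendsto (z₂ / t)).const_mul _)).mul
      (((thF_tendsto _ hε0 hε1).div (thF_tendsto _ hε0 hε1) one_ne_zero).const_mul _)
  have val : (sq h - (sq h)⁻¹) * 1 * ((sq (z₂ / t) - (sq (z₂ / t))⁻¹) * 1) *
        (((sq (z₁ / t))⁻¹ * (t / z₁) ^ m) * (1 / 1)) =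
      (sq h)⁻¹ * (sq (z₁ * z₂ / t ^ 2))⁻¹ * ((1 - h) * (t / z₁) ^ m * (1 - z₂ / t)) := by
    have e1 : sq h - (sq h)⁻¹ = -(sq h)⁻¹ * (1 - h) := by
      have := sne h hh
      rw [← congrArg (fun y => -(sq h)⁻¹ * (1 - y)) (hsq h)]
      field_simp
      ring
    have e2 : sq (z₂ / t) - (sq (z₂ / t))⁻¹ = -(sq (z₂ / t))⁻¹ * (1 - z₂ / t) := by
      have := sne _ hw
      rw [← congrArg (fun y => -(sq (z₂ / t))⁻¹ * (1 - y)) (hsq (z₂ / t))]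
      field_simp
      ring
    rw [hsq₂, e1, e2, mul_inv]
    ring
  rw [val] at lim
  refine lim.congr' ?_
  filter_upwards [ev_small] with q hq
  have h0 := hq.1
  have h1 : q < 1 := by linarith [hq.2]
  have hqc : (q : ℂ) ≠ 0 := by exact_mod_cast h0.ne'
  have hQne : Q q ≠ 0 := by
    rw [hQ]; exact_mod_cast (Real.rpow_pos_of_pos h0 _).ne'
  have hr : ((q ^ ε : ℝ) : ℂ) ≠ 0 := by exact_mod_cast (Real.rpow_pos_of_pos h0 _).ne'
  have hQ2 : Q q ^ 2 = Qe q := by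
    rw [hQ, hQe]
    have : (q ^ (((m : ℝ) + ε) / 2)) ^ 2 = q ^ ((m : ℝ) + ε) := by
      rw [← Real.rpow_natCast, ← Real.rpow_mul h0.le]
      congr 1
      push_cast
      ring
    exact_mod_cast this
  have hQe2 : Qe q = (q : ℂ) ^ m * ((q ^ ε : ℝ) : ℂ) := by
    rw [hQe]
    have : q ^ ((m : ℝ) + ε) = q ^ m * q ^ ε := by
      rw [Real.rpow_add h0, Real.rpow_intCast]
    exact_mod_cast this
  obtain ⟨c, hc, hF⟩ := thF_zstep h0 h1 m
  rw [theta_factor h0 h1 (sq (h * (z₁ / t))) (Q q) (h * (z₁ / t)) (Qe q)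
      (sne _ (mul_ne_zero hh hzt)) hQne (by rw [mul_pow, hsq, hQ2]),
    theta_factor h0 h1 (sq h) (Q q) h (Qe q) (sne _ hh) hQne (by rw [mul_pow, hsq, hQ2]),
    hQe2]
  generalize ((q ^ ε : ℝ) : ℂ) = r at *
  have ha := hF (h * (z₁ / t) * r) (mul_ne_zero (mul_ne_zero hh hzt) hr)
  have hb := hF (h * r) (mul_ne_zero hh hr)
  rw [show h * (z₁ / t) * ((q : ℂ) ^ m * r) = (q : ℂ) ^ m * (h * (z₁ / t) * r) by ring, ha,
    show h * ((q : ℂ) ^ m * r) = (q : ℂ) ^ m * (h * r) by ring, hb, mul_div_assoc]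
  congr 1
  rw [← mul_assoc, ← mul_assoc (-(sq h * Q q)⁻¹), mul_div_mul_comm]
  congr 1
  have e3 : (h * (z₁ / t) * r) ^ (-m) = (h * r) ^ (-m) * (t / z₁) ^ m := by
    rw [show h * (z₁ / t) * r = (h * r) * (z₁ / t) by ring, mul_zpow, zpow_neg (z₁ / t),
      ← inv_zpow, inv_div]
  have hne : (h * r) ^ (-m) ≠ 0 := zpow_ne_zero _ (mul_ne_zero hh hr)
  rw [e3, hsq₁]
  have n1 := sne h hh
  have n2 := sne _ hzt
  generalize (h * r) ^ (-m) = A at *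
  generalize (t / z₁) ^ m = B at *
  generalize sq (z₁ / t) = C at *
  field_simp
end
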